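/- arXiv:2206.06946 — 2 statements merged into one kernel-verified Lean document; each statement's English description precedes it below -/
import Mathlib

section
/- With the notation of the previous minimum value m: if the pairs (a,b) and (a',b') are disjoint in the cyclic order of the acausal curve (i.e. a', b' lie in the same component of the circle minus {a,b}), then m > 1, so the two spacelike geodesics ℓ = [a,b] and ℓ' = [a',b'] are disjoint and ℓ ∪ ℓ' is acausal; if the pairs are crossing, then m ≤ 1, and there is a timelike geodesic segment orthogonal to both ℓ and ℓ' joining the points realizing the minimum. -/
/-- The signature `(2, n+1)` bilinear form on `ℝ^{n+3}`. -/
noncomputable def bform (n : ℕ) (x y : Fin (n + 3) → ℝ) : ℝ :=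
  ∑ i : Fin (n + 3), (if (i : ℕ) < 2 then (1 : ℝ) else -1) * (x i * y i)

/-- The unit speed spacelike geodesic `ℓ(t) = (e^t a + e^{-t} b)/√(-2⟨a,b⟩)` of `Ĥ^{2,n}`. -/
noncomputable def lgeo (n : ℕ) (a b : Fin (n + 3) → ℝ) (t : ℝ) : Fin (n + 3) → ℝ :=
  (Real.sqrt (-2 * bform n a b))⁻¹ • (Real.exp t • a + Real.exp (-t) • b)

/-- The velocity `ℓ̇(t) = (e^t a - e^{-t} b)/√(-2⟨a,b⟩)` of the geodesic `lgeo`. -/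
noncomputable def dlgeo (n : ℕ) (a b : Fin (n + 3) → ℝ) (t : ℝ) : Fin (n + 3) → ℝ :=
  (Real.sqrt (-2 * bform n a b))⁻¹ • (Real.exp t • a - Real.exp (-t) • b)

/-- Two pairs of points of a circle, seen in an affine chart `ℝ`, are crossing if exactly
one of `x', y'` lies between `x` and `y`. -/
def Crossing (x y x' y' : ℝ) : Prop :=
  Xor' (x' ∈ Set.Ioo (min x y) (max x y)) (y' ∈ Set.Ioo (min x y) (max x y))

lemma bform_comm (n : ℕ) (x y : Fin (n + 3) → ℝ) : bform n x y = bform n y x := by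
  simp only [bform, mul_comm (x _)]

lemma bform_add_left (n : ℕ) (x y z : Fin (n + 3) → ℝ) :
    bform n (x + y) z = bform n x z + bform n y z := by
  simp only [bform, ← Finset.sum_add_distrib, Pi.add_apply]
  exact Finset.sum_congr rfl fun i _ => by ring

lemma bform_smul_left (n : ℕ) (c : ℝ) (x y : Fin (n + 3) → ℝ) :
    bform n (c • x) y = c * bform n x y := by
  simp only [bform, Finset.mul_sum, Pi.smul_apply, smul_eq_mul]
  exact Finset.sum_congr rfl fun i _ => by ring

lemma bform_sub_left (n : ℕ) (x y z : Fin (n + 3) → ℝ) :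
    bform n (x - y) z = bform n x z - bform n y z := by
  rw [sub_eq_add_neg, ← neg_one_smul ℝ y, bform_add_left, bform_smul_left]
  ring

lemma bform_add_right (n : ℕ) (x y z : Fin (n + 3) → ℝ) :
    bform n z (x + y) = bform n z x + bform n z y := by
  simp only [bform_comm n z, bform_add_left]

lemma bform_smul_right (n : ℕ) (c : ℝ) (x y : Fin (n + 3) → ℝ) :
    bform n y (c • x) = c * bform n y x := by
  simp only [bform_comm n y, bform_smul_left]

lemma bform_sub_right (n : ℕ) (x y z : Fin (n + 3) → ℝ) :
    bform n z (x - y) = bform n z x - bform n z y := by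
  simp only [bform_comm n z, bform_sub_left]

lemma bform_zero_left (n : ℕ) (x : Fin (n + 3) → ℝ) : bform n 0 x = 0 := by
  simp [bform]

lemma bform_self_of_coord_eq_zero (n : ℕ) (x : Fin (n + 3) → ℝ) (h0 : x 0 = 0) (h1 : x 1 = 0) :
    bform n x x = -∑ i, x i ^ 2 := by
  rw [bform, ← Finset.sum_neg_distrib]
  refine Finset.sum_congr rfl fun i _ => ?_
  split_ifs with hi
  · have : i = 0 ∨ i = 1 := by
      rcases (by omega : (i : ℕ) = 0 ∨ (i : ℕ) = 1) with h | h
      · exact Or.inl (Fin.ext h)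
      · exact Or.inr (Fin.ext h)
    rcases this with rfl | rfl
    · simp [h0]
    · simp [h1]
  · ring

/-- The orthogonal complement of a positive definite plane is negative definite. -/
lemma eq_zero_of_orthogonal (n : ℕ) {u v w : Fin (n + 3) → ℝ}
    (hu : 0 < bform n u u) (hv : 0 < bform n v v) (huv : bform n u v = 0)
    (huw : bform n u w = 0) (hvw : bform n v w = 0) (hw : 0 ≤ bform n w w) : w = 0 := by
  let M : Matrix (Fin 2) (Fin 3) ℝ := !![u 0, v 0, w 0; u 1, v 1, w 1]
  have hker : M.mulVecLin.ker ≠ ⊥ := LinearMap.ker_ne_bot_of_finrank_lt (by simp)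
  obtain ⟨l, hl, hl0⟩ := Submodule.exists_mem_ne_zero_of_ne_bot hker
  have hMl : M.mulVec l = 0 := by simpa using hl
  have e0 := congrFun hMl 0
  have e1 := congrFun hMl 1
  simp [M, Matrix.mulVec, dotProduct, Fin.sum_univ_three] at e0 e1
  set x : Fin (n + 3) → ℝ := l 0 • u + l 1 • v + l 2 • w with hx
  have hxx : bform n x x = -∑ i, x i ^ 2 := by
    apply bform_self_of_coord_eq_zero
    · simp only [hx, Pi.add_apply, Pi.smul_apply, smul_eq_mul]; linarith
    · simp only [hx, Pi.add_apply, Pi.smul_apply, smul_eq_mul]; linarith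
  have hxx' : bform n x x =
      l 0 ^ 2 * bform n u u + l 1 ^ 2 * bform n v v + l 2 ^ 2 * bform n w w := by
    simp only [hx, bform_add_left, bform_add_right, bform_smul_left, bform_smul_right,
      bform_comm n v u, bform_comm n w u, bform_comm n w v, huv, huw, hvw]
    ring
  have hs : 0 ≤ ∑ i, x i ^ 2 := Finset.sum_nonneg fun i _ => sq_nonneg _
  have h0 := mul_nonneg (sq_nonneg (l 0)) hu.le
  have h1 := mul_nonneg (sq_nonneg (l 1)) hv.le
  have h2 := mul_nonneg (sq_nonneg (l 2)) hw
  have l0 : l 0 = 0 := by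
    have : l 0 ^ 2 * bform n u u = 0 := by linarith
    simpa [hu.ne'] using this
  have l1 : l 1 = 0 := by
    have : l 1 ^ 2 * bform n v v = 0 := by linarith
    simpa [hv.ne'] using this
  have l2 : l 2 ≠ 0 := by
    intro l2
    apply hl0
    ext i
    fin_cases i <;> simp [l0, l1, l2]
  have hs0 : ∑ i, x i ^ 2 = 0 := by linarith
  rw [Finset.sum_eq_zero_iff_of_nonneg fun i _ => sq_nonneg _] at hs0
  ext i
  have := hs0 i (Finset.mem_univ i)
  simpa [hx, l0, l1, l2] using this

/-- The component of `c` orthogonal to `a` and `b`, up to the factor `⟨a,b⟩`. -/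
noncomputable def orthoPart (n : ℕ) (a b c : Fin (n + 3) → ℝ) : Fin (n + 3) → ℝ :=
  bform n a b • c - bform n b c • a - bform n a c • b

lemma bform_orthoPart (n : ℕ) (a b c x : Fin (n + 3) → ℝ) :
    bform n (orthoPart n a b c) x =
      bform n a b * bform n c x - bform n b c * bform n a x - bform n a c * bform n b x := by
  simp only [orthoPart, bform_sub_left, bform_smul_left]

lemma bform_orthoPart_orthoPart (n : ℕ) {a b : Fin (n + 3) → ℝ} (c d : Fin (n + 3) → ℝ)
    (ha : bform n a a = 0) (hb : bform n b b = 0) :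
    bform n (orthoPart n a b c) (orthoPart n a b d) =
      bform n a b * (bform n a b * bform n c d - bform n b c * bform n a d
        - bform n a c * bform n b d) := by
  rw [bform_orthoPart, bform_comm n c, bform_comm n a (orthoPart n a b d),
    bform_comm n b (orthoPart n a b d)]
  simp only [bform_orthoPart, ha, hb, bform_comm n b a, bform_comm n d]
  ring

/-- The orthogonal complement of a `(2,1)`-subspace is negative definite. -/
lemma eq_zero_of_orthogonal_triple (n : ℕ) {a b c w : Fin (n + 3) → ℝ}
    (ha : bform n a a = 0) (hb : bform n b b = 0) (hc : bform n c c = 0)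
    (hab : bform n a b < 0) (hac : bform n a c < 0) (hbc : bform n b c < 0)
    (hwa : bform n a w = 0) (hwb : bform n b w = 0) (hwc : bform n c w = 0)
    (hw : 0 ≤ bform n w w) : w = 0 := by
  refine eq_zero_of_orthogonal n (u := a - b) (v := orthoPart n a b c) ?_ ?_ ?_ ?_ ?_ hw
  · simp only [bform_sub_left, bform_sub_right, ha, hb, bform_comm n b a]
    linarith
  · rw [bform_orthoPart_orthoPart n c c ha hb, hc]
    nlinarith [mul_pos (neg_pos.2 hab) (mul_pos_of_neg_of_neg hbc hac)]
  · rw [bform_comm, bform_orthoPart]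
    simp only [bform_sub_right, ha, hb, bform_comm n b a, bform_comm n c a, bform_comm n c b]
    ring
  · simp only [bform_sub_left, hwa, hwb, sub_zero]
  · simp only [bform_orthoPart, hwa, hwb, hwc]
    ring

/-- The Gram determinant of four isotropic vectors with negative products is nonnegative. -/
lemma gram_nonneg (n : ℕ) {a b c d : Fin (n + 3) → ℝ}
    (ha : bform n a a = 0) (hb : bform n b b = 0) (hc : bform n c c = 0) (hd : bform n d d = 0)
    (hab : bform n a b < 0) (hac : bform n a c < 0) (hbc : bform n b c < 0) :
    4 * ((bform n a c * bform n b d) * (bform n a d * bform n b c)) ≤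
      (bform n a b * bform n c d - bform n a c * bform n b d - bform n a d * bform n b c) ^ 2 := by
  have hcc := bform_orthoPart_orthoPart n c c ha hb
  have hcd := bform_orthoPart_orthoPart n c d ha hb
  have hdd := bform_orthoPart_orthoPart n d d ha hb
  rw [hc] at hcc
  rw [hd] at hdd
  have hN : 0 < bform n (orthoPart n a b c) (orthoPart n a b c) := by
    rw [hcc]
    nlinarith [mul_pos (neg_pos.2 hab) (mul_pos_of_neg_of_neg hbc hac)]
  by_contra! hlt
  set C := orthoPart n a b c with hC
  set D := orthoPart n a b d with hD
  have hoa : ∀ x, bform n a (orthoPart n a b x) = 0 := fun x => by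
    rw [bform_comm, bform_orthoPart]
    simp only [ha, bform_comm n b a, bform_comm n x]
    ring
  have hob : ∀ x, bform n b (orthoPart n a b x) = 0 := fun x => by
    rw [bform_comm, bform_orthoPart]
    simp only [hb, bform_comm n x]
    ring
  have hww : bform n (bform n C C • D - bform n C D • C) (bform n C C • D - bform n C D • C) =
      bform n C C * (bform n C C * bform n D D - bform n C D ^ 2) := by
    simp only [bform_sub_left, bform_sub_right, bform_smul_left, bform_smul_right,
      bform_comm n D C]
    ring
  have hpos : 0 < bform n C C * bform n D D - bform n C D ^ 2 := by
    rw [hcc, hcd, hdd]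
    have := mul_pos (pow_pos (neg_pos.2 hab) 2) (sub_pos.2 hlt)
    nlinarith
  have hw0 : bform n C C • D - bform n C D • C = 0 := by
    refine eq_zero_of_orthogonal n (u := a - b) (v := C) ?_ hN ?_ ?_ ?_ ?_
    · simp only [bform_sub_left, bform_sub_right, ha, hb, bform_comm n b a]
      linarith
    · simp only [bform_sub_left, hC, hoa, hob, sub_zero]
    · simp only [bform_sub_left, bform_sub_right, bform_smul_right, hC, hD, hoa, hob]
      ring
    · simp only [bform_sub_right, bform_smul_right]
      ring
    · rw [hww]
      exact (mul_pos hN hpos).le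
  have := mul_pos hN hpos
  rw [← hww, hw0, bform_zero_left] at this
  exact this.false

lemma sqrt_add_sqrt_le {p q r : ℝ} (hp : 0 < p) (hq : 0 < q) (hr : 0 < r)
    (hdet : 4 * (p * r) ≤ (q - p - r) ^ 2) (hqp : q < p + r) (hrp : r < p + q) :
    √q + √r ≤ √p := by
  have hx := Real.sqrt_pos.2 hp
  have hy := Real.sqrt_pos.2 hq
  have hz := Real.sqrt_pos.2 hr
  rw [← Real.sq_sqrt hp.le, ← Real.sq_sqrt hq.le, ← Real.sq_sqrt hr.le] at hdet hqp hrp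
  set x := √p
  set y := √q
  set z := √r
  by_contra! h
  have h1 : 0 < x + z - y := by nlinarith
  have h2 : 0 < x + y - z := by nlinarith
  have := mul_pos (mul_pos (mul_pos h1 h2) (sub_pos.2 h)) (add_pos (add_pos hx hy) hz)
  nlinarith

/-- The Ptolemy inequality along an acausal curve, for parameters in increasing order. -/
lemma ptolemy_of_lt {G : ℝ → ℝ → ℝ} (hcont : ∀ s, Continuous (G s))
    (hsymm : ∀ s t, G s t = G t s) (hself : ∀ s, G s s = 0)
    (hpos : ∀ s t, s ≠ t → 0 < G s t)
    (hdet : ∀ a b c d, a ≠ b → a ≠ c → b ≠ c →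
      4 * ((G a c * G b d) * (G a d * G b c)) ≤
        (G a b * G c d - G a c * G b d - G a d * G b c) ^ 2)
    {s t u v : ℝ} (hst : s < t) (htu : t < u) (huv : u < v) :
    √(G s t * G u v) + √(G s v * G t u) ≤ √(G s u * G t v) := by
  have hP : ∀ {x y}, x < y → 0 < G x y := fun h => hpos _ _ h.ne
  have hsu := hst.trans htu
  have htv := htu.trans huv
  have hsv := hsu.trans huv
  refine sqrt_add_sqrt_le (mul_pos (hP hsu) (hP htv)) (mul_pos (hP hst) (hP huv))
    (mul_pos (hP hsv) (hP htu)) (hdet s t u v hst.ne hsu.ne htu.ne) ?_ ?_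
  · by_contra! h
    let k : ℝ → ℝ := fun x => G s x * G u v - G s u * G v x - G s v * G u x
    have hk : Continuous k := by fun_prop
    have hks : k s ≤ 0 := by
      have := mul_pos (hP hsu) (hP hsv)
      simp only [k, hself, hsymm v s, hsymm u s]
      linarith
    have hkt : 0 ≤ k t := by
      simp only [k, hsymm v t, hsymm u t]
      linarith
    obtain ⟨x, ⟨hsx, hxt⟩, hx⟩ := intermediate_value_Icc hst.le hk.continuousOn ⟨hks, hkt⟩
    rcases hsx.eq_or_lt with rfl | hsx
    · have := mul_pos (hP hsu) (hP hsv)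
      simp only [k, hself, hsymm v s, hsymm u s] at hx
      linarith
    · have hxu := hxt.trans_lt htu
      have := hdet s x u v hsx.ne hsu.ne hxu.ne
      have h4 := mul_pos (mul_pos (hP hsu) (hP (hxu.trans huv))) (mul_pos (hP hsv) (hP hxu))
      simp only [k, hsymm v x, hsymm u x] at hx
      rw [hx] at this
      linarith
  · by_contra! h
    let k : ℝ → ℝ := fun x => G s v * G u x - G s x * G u v - G s u * G v x
    have hk : Continuous k := by fun_prop
    have hku : k u ≤ 0 := by
      have := mul_pos (hP hsu) (hP huv)
      simp only [k, hself, hsymm v u]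
      linarith
    have hkt : 0 ≤ k t := by
      simp only [k, hsymm v t, hsymm u t]
      linarith
    obtain ⟨x, ⟨htx, hxu⟩, hx⟩ := intermediate_value_Icc' htu.le hk.continuousOn ⟨hku, hkt⟩
    rcases hxu.eq_or_lt with rfl | hxu
    · have := mul_pos (hP hsu) (hP huv)
      simp only [k, hself, hsymm v x] at hx
      linarith
    · have hsx := hst.trans_le htx
      have := hdet s x u v hsx.ne hsu.ne hxu.ne
      have h4 := mul_pos (mul_pos (hP hsu) (hP (hxu.trans huv))) (mul_pos (hP hsx) (hP huv))
      simp only [k, hsymm v x, hsymm u x] at hx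
      nlinarith

lemma Crossing.swap_left {x y x' y' : ℝ} : Crossing y x x' y' ↔ Crossing x y x' y' := by
  rw [Crossing, Crossing, min_comm, max_comm]

lemma Crossing.swap_right {x y x' y' : ℝ} : Crossing x y y' x' ↔ Crossing x y x' y' :=
  iff_of_eq (xor_comm _ _)

/-- Crossing and disjoint pairs are distinguished by the Ptolemy inequality. -/
lemma ptolemy_crossing {G : ℝ → ℝ → ℝ} (hsymm : ∀ s t, G s t = G t s)
    (hpos : ∀ s t, s ≠ t → 0 < G s t)
    (hG : ∀ s t u v, s < t → t < u → u < v →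
      √(G s t * G u v) + √(G s v * G t u) ≤ √(G s u * G t v))
    {x y x' y' : ℝ} (hxy : x ≠ y) (hxx' : x ≠ x') (hxy' : x ≠ y') (hyx' : y ≠ x') (hyy' : y ≠ y')
    (hx'y' : x' ≠ y') :
    (Crossing x y x' y' → √(G x x' * G y y') + √(G x y' * G y x') ≤ √(G x y * G x' y')) ∧
    (¬ Crossing x y x' y' → √(G x y * G x' y') < √(G x x' * G y y') + √(G x y' * G y x')) := by
  wlog h : x < y generalizing x y
  · have := this hxy.symm hyx' hyy' hxx' hxy' (lt_of_le_of_ne (not_lt.1 h) hxy.symm)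
    rwa [Crossing.swap_left, hsymm y x, add_comm, mul_comm (G y y'), mul_comm (G y x')] at this
  wlog h' : x' < y' generalizing x' y'
  · have := this hx'y'.symm hxy' hxx' hyy' hyx' (lt_of_le_of_ne (not_lt.1 h') hx'y'.symm)
    rwa [Crossing.swap_right, hsymm y' x', add_comm] at this
  have hc : Crossing x y x' y' ↔
      ((x < x' ∧ x' < y) ∧ ¬ (x < y' ∧ y' < y)) ∨ ((x < y' ∧ y' < y) ∧ ¬ (x < x' ∧ x' < y)) := by
    rw [Crossing, min_eq_left h.le, max_eq_right h.le]
    rfl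
  have hq : 0 < √(G x x' * G y y') := Real.sqrt_pos.2 (mul_pos (hpos _ _ hxx') (hpos _ _ hyy'))
  have hr : 0 < √(G x y' * G y x') := Real.sqrt_pos.2 (mul_pos (hpos _ _ hxy') (hpos _ _ hyx'))
  rw [hc]
  rcases hxx'.lt_or_gt with h1 | h1
  · rcases hyx'.lt_or_gt with h2 | h2
    · have := hG x y x' y' h h2 h'
      exact ⟨fun _ => by grind, fun _ => by linarith⟩
    · rcases hyy'.lt_or_gt with h3 | h3
      · have := hG x x' y y' h1 h2 h3
        rw [hsymm x' y] at this
        exact ⟨fun _ => this, fun _ => by grind⟩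
      · have := hG x x' y' y h1 h' h3
        rw [hsymm y' y, hsymm x' y] at this
        exact ⟨fun _ => by grind, fun _ => by linarith⟩
  · rcases hxy'.lt_or_gt with h2 | h2
    · rcases hyy'.lt_or_gt with h3 | h3
      · have := hG x' x y y' h1 h h3
        rw [hsymm x' x, mul_comm (G x' y'), hsymm x' y, mul_comm (G y x')] at this
        exact ⟨fun _ => by grind, fun _ => by linarith⟩
      · have := hG x' x y' y h1 h2 h3
        rw [hsymm x' x, hsymm y' y, hsymm x' y, mul_comm (G y x'), mul_comm (G x' y')] at this
        exact ⟨fun _ => this, fun _ => by grind⟩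
    · have := hG x' y' x y h' h2 h
      rw [hsymm x' x, hsymm y' y, hsymm x' y, hsymm y' x, mul_comm (G y x'),
        mul_comm (G x' y')] at this
      exact ⟨fun _ => by grind, fun _ => by linarith⟩

lemma two_mul_sqrt_le_add {A D α : ℝ} (hA : 0 < A) (hD : 0 < D) :
    2 * √(A * D) ≤ Real.exp α * A + Real.exp (-α) * D := by
  have h : Real.exp α * Real.exp (-α) = 1 := by rw [← Real.exp_add]; simp
  have hle : √(A * D) ≤ (Real.exp α * A + Real.exp (-α) * D) / 2 := by
    refine Real.sqrt_le_iff.2 ⟨by positivity, ?_⟩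
    have : A * D = (Real.exp α * A) * (Real.exp (-α) * D) := by linear_combination -(A * D) * h
    rw [this]
    nlinarith [sq_nonneg (Real.exp α * A - Real.exp (-α) * D)]
  linarith

lemma exists_exp_mul_eq_sqrt {A D : ℝ} (hA : 0 < A) (hD : 0 < D) :
    ∃ α, Real.exp α * A = √(A * D) ∧ Real.exp (-α) * D = √(A * D) := by
  have hA' := Real.sqrt_pos.2 hA
  have hD' := Real.sqrt_pos.2 hD
  refine ⟨Real.log (√D / √A), ?_, ?_⟩
  · rw [Real.exp_log (by positivity), Real.sqrt_mul hA.le]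
    nth_rw 2 [← Real.sq_sqrt hA.le]
    field_simp
  · rw [Real.exp_neg, Real.exp_log (by positivity), Real.sqrt_mul hA.le]
    nth_rw 2 [← Real.sq_sqrt hD.le]
    field_simp

/-- The minimum value of `-⟨ℓ(t),ℓ'(s)⟩`. -/
noncomputable def minValue (n : ℕ) (a b a' b' : Fin (n + 3) → ℝ) : ℝ :=
  √((bform n a a' * bform n b b') / (bform n a b * bform n a' b')) +
    √((bform n a b' * bform n b a') / (bform n a b * bform n a' b'))

lemma minValue_eq (n : ℕ) {a b a' b' : Fin (n + 3) → ℝ}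
    (hab : bform n a b < 0) (hab' : bform n a' b' < 0) :
    minValue n a b a' b' = (√(bform n a a' * bform n b b') + √(bform n a b' * bform n b a')) /
      √(bform n a b * bform n a' b') := by
  have hp := (mul_pos_of_neg_of_neg hab hab').le
  rw [minValue, Real.sqrt_div' _ hp, Real.sqrt_div' _ hp, add_div]

lemma minValue_eq_mul (n : ℕ) {a b a' b' : Fin (n + 3) → ℝ}
    (hab : bform n a b < 0) (hab' : bform n a' b' < 0) :
    minValue n a b a' b' = (√(-2 * bform n a b))⁻¹ * (√(-2 * bform n a' b'))⁻¹ *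
      (2 * √(bform n a a' * bform n b b') + 2 * √(bform n a b' * bform n b a')) := by
  have hp := mul_pos_of_neg_of_neg hab hab'
  have hs : √(-2 * bform n a b) * √(-2 * bform n a' b') = 2 * √(bform n a b * bform n a' b') := by
    rw [← Real.sqrt_mul (by linarith), show -2 * bform n a b * (-2 * bform n a' b') =
      2 ^ 2 * (bform n a b * bform n a' b') by ring, Real.sqrt_mul (by norm_num),
      Real.sqrt_sq (by norm_num)]
  rw [minValue_eq n hab hab', ← mul_inv, hs]
  have := Real.sqrt_pos.2 hp
  field_simp

lemma bform_lgeo_left (n : ℕ) (a b x : Fin (n + 3) → ℝ) (t : ℝ) :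
    bform n (lgeo n a b t) x = (√(-2 * bform n a b))⁻¹ *
      (Real.exp t * bform n a x + Real.exp (-t) * bform n b x) := by
  simp only [lgeo, bform_smul_left, bform_add_left]

lemma bform_lgeo_right (n : ℕ) (a b x : Fin (n + 3) → ℝ) (t : ℝ) :
    bform n x (lgeo n a b t) = (√(-2 * bform n a b))⁻¹ *
      (Real.exp t * bform n x a + Real.exp (-t) * bform n x b) := by
  simp only [lgeo, bform_smul_right, bform_add_right]

lemma bform_dlgeo_left (n : ℕ) (a b x : Fin (n + 3) → ℝ) (t : ℝ) :
    bform n (dlgeo n a b t) x = (√(-2 * bform n a b))⁻¹ *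
      (Real.exp t * bform n a x - Real.exp (-t) * bform n b x) := by
  simp only [dlgeo, bform_smul_left, bform_sub_left]

lemma bform_lgeo_self (n : ℕ) {a b : Fin (n + 3) → ℝ} (ha : bform n a a = 0)
    (hb : bform n b b = 0) (hab : bform n a b < 0) (t : ℝ) :
    bform n (lgeo n a b t) (lgeo n a b t) = -1 := by
  have h : Real.exp t * Real.exp (-t) = 1 := by rw [← Real.exp_add]; simp
  have hs : (√(-2 * bform n a b))⁻¹ ^ 2 * (-2 * bform n a b) = 1 := by
    rw [inv_pow, Real.sq_sqrt (by linarith), inv_mul_cancel₀ (by linarith)]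
  rw [bform_lgeo_left, bform_lgeo_right, bform_lgeo_right,
    ha, hb, bform_comm n b a]
  linear_combination -(Real.exp t * Real.exp (-t)) * hs - h

lemma bform_dlgeo_lgeo (n : ℕ) {a b : Fin (n + 3) → ℝ} (ha : bform n a a = 0)
    (hb : bform n b b = 0) (t : ℝ) :
    bform n (dlgeo n a b t) (lgeo n a b t) = 0 := by
  rw [bform_dlgeo_left, bform_lgeo_right, bform_lgeo_right,
    ha, hb, bform_comm n b a]
  ring

lemma bform_eq_zero_of_lgeo (n : ℕ) {a b x : Fin (n + 3) → ℝ} (hab : bform n a b < 0) {t : ℝ}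
    (h : bform n (lgeo n a b t) x = 0) (h' : bform n (dlgeo n a b t) x = 0) :
    bform n a x = 0 ∧ bform n b x = 0 := by
  have hs0 : √(-2 * bform n a b) ≠ 0 := (Real.sqrt_pos.2 (by linarith)).ne'
  rw [bform_lgeo_left] at h
  rw [bform_dlgeo_left] at h'
  have e1 := (mul_eq_zero.1 h).resolve_left (inv_ne_zero hs0)
  have e2 := (mul_eq_zero.1 h').resolve_left (inv_ne_zero hs0)
  constructor
  · have : Real.exp t * bform n a x = 0 := by linarith
    exact (mul_eq_zero.1 this).resolve_left (Real.exp_ne_zero _)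
  · have : Real.exp (-t) * bform n b x = 0 := by linarith
    exact (mul_eq_zero.1 this).resolve_left (Real.exp_ne_zero _)

lemma minValue_le (n : ℕ) {a b a' b' : Fin (n + 3) → ℝ}
    (hab : bform n a b < 0) (hab' : bform n a' b' < 0) (haa' : bform n a a' < 0)
    (hbb' : bform n b b' < 0) (hab'' : bform n a b' < 0) (hba' : bform n b a' < 0) (t s : ℝ) :
    minValue n a b a' b' ≤ -(bform n (lgeo n a b t) (lgeo n a' b' s)) := by
  have h1 := two_mul_sqrt_le_add (α := t + s) (neg_pos.2 haa') (neg_pos.2 hbb')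
  have h2 := two_mul_sqrt_le_add (α := t - s) (neg_pos.2 hab'') (neg_pos.2 hba')
  rw [neg_mul_neg] at h1 h2
  rw [minValue_eq_mul n hab hab', bform_lgeo_left, bform_lgeo_right, bform_lgeo_right]
  refine (mul_le_mul_of_nonneg_left (add_le_add h1 h2) (by positivity)).trans_eq ?_
  rw [neg_add, neg_sub, sub_eq_add_neg, sub_eq_add_neg, Real.exp_add, Real.exp_add, Real.exp_add,
    Real.exp_add]
  ring

lemma exists_lgeo_eq_minValue (n : ℕ) {a b a' b' : Fin (n + 3) → ℝ}
    (hab : bform n a b < 0) (hab' : bform n a' b' < 0) (haa' : bform n a a' < 0)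
    (hbb' : bform n b b' < 0) (hab'' : bform n a b' < 0) (hba' : bform n b a' < 0) :
    ∃ t s, bform n (lgeo n a b t) (lgeo n a' b' s) = -minValue n a b a' b' ∧
      bform n (dlgeo n a b t) (lgeo n a' b' s) = 0 ∧
      bform n (dlgeo n a' b' s) (lgeo n a b t) = 0 := by
  obtain ⟨α, h1, h2⟩ := exists_exp_mul_eq_sqrt (neg_pos.2 haa') (neg_pos.2 hbb')
  obtain ⟨β, h3, h4⟩ := exists_exp_mul_eq_sqrt (neg_pos.2 hab'') (neg_pos.2 hba')
  obtain ⟨t, s, rfl, rfl⟩ : ∃ t s : ℝ, α = t + s ∧ β = t - s :=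
    ⟨(α + β) / 2, (α - β) / 2, by ring, by ring⟩
  rw [neg_mul_neg] at h1 h2 h3 h4
  rw [neg_add, Real.exp_add] at h2
  rw [neg_sub, sub_eq_add_neg, Real.exp_add] at h4
  rw [Real.exp_add] at h1
  rw [sub_eq_add_neg, Real.exp_add] at h3
  refine ⟨t, s, ?_, ?_, ?_⟩
  · rw [minValue_eq_mul n hab hab', bform_lgeo_left, bform_lgeo_right, bform_lgeo_right]
    linear_combination -(√(-2 * bform n a b))⁻¹ * (√(-2 * bform n a' b'))⁻¹ * (h1 + h2 + h3 + h4)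
  · rw [bform_dlgeo_left, bform_lgeo_right, bform_lgeo_right]
    linear_combination -(√(-2 * bform n a b))⁻¹ * (√(-2 * bform n a' b'))⁻¹ * (h1 - h2 + h3 - h4)
  · rw [bform_dlgeo_left, bform_lgeo_right, bform_lgeo_right, bform_comm n a' a,
      bform_comm n a' b, bform_comm n b' a, bform_comm n b' b]
    linear_combination -(√(-2 * bform n a b))⁻¹ * (√(-2 * bform n a' b'))⁻¹ * (h1 - h2 - h3 + h4)

lemma exists_unit_timelike_orthogonal (n : ℕ) (hn : 1 ≤ n) {a b c : Fin (n + 3) → ℝ}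
    (ha : bform n a a = 0) (hb : bform n b b = 0) (hc : bform n c c = 0)
    (hab : bform n a b < 0) (hac : bform n a c < 0) (hbc : bform n b c < 0) :
    ∃ v, bform n v v = -1 ∧ bform n a v = 0 ∧ bform n b v = 0 ∧ bform n c v = 0 := by
  let f : (Fin (n + 3) → ℝ) →ₗ[ℝ] (Fin 3 → ℝ) := LinearMap.pi
    ![{ toFun := bform n a, map_add' := fun x y => bform_add_right n x y a,
        map_smul' := fun k x => bform_smul_right n k x a },
      { toFun := bform n b, map_add' := fun x y => bform_add_right n x y b,
        map_smul' := fun k x => bform_smul_right n k x b },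
      { toFun := bform n c, map_add' := fun x y => bform_add_right n x y c,
        map_smul' := fun k x => bform_smul_right n k x c }]
  have hker : LinearMap.ker f ≠ ⊥ := LinearMap.ker_ne_bot_of_finrank_lt (by simp; omega)
  obtain ⟨w, hw, hw0⟩ := Submodule.exists_mem_ne_zero_of_ne_bot hker
  have hfw : f w = 0 := hw
  have ea : bform n a w = 0 := congrFun hfw 0
  have eb : bform n b w = 0 := congrFun hfw 1
  have ec : bform n c w = 0 := congrFun hfw 2
  have hneg : bform n w w < 0 := by
    by_contra! h
    exact hw0 (eq_zero_of_orthogonal_triple n ha hb hc hab hac hbc ea eb ec h)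
  have hs : √(-bform n w w) ^ 2 = -bform n w w := Real.sq_sqrt (by linarith)
  have hs0 : √(-bform n w w) ≠ 0 := (Real.sqrt_pos.2 (by linarith)).ne'
  refine ⟨(√(-bform n w w))⁻¹ • w, ?_, ?_, ?_, ?_⟩
  · rw [bform_smul_left, bform_smul_right]
    field_simp
    linarith
  all_goals simp only [bform_smul_right, ea, eb, ec, mul_zero]

/-- Two points of the quadric `⟨x,x⟩ = -1` with `|⟨x,y⟩| < 1` lie on a timelike geodesic. -/
lemma exists_timelike_geodesic (n : ℕ) {x y : Fin (n + 3) → ℝ}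
    (hx : bform n x x = -1) (hy : bform n y y = -1)
    (hlt : -1 < bform n x y) (hlt' : bform n x y < 1) :
    ∃ r : ℝ, ∃ v, bform n v v = -1 ∧ bform n x v = 0 ∧ y = Real.cos r • x + Real.sin r • v ∧
      ∀ z, bform n z x = 0 → bform n z y = 0 → bform n z v = 0 := by
  obtain ⟨r, hr, hs⟩ : ∃ r, Real.cos r = -bform n x y ∧ Real.sin r ≠ 0 := by
    refine ⟨Real.arccos (-bform n x y), Real.cos_arccos (by linarith) (by linarith), ?_⟩
    rw [Real.sin_arccos]
    exact (Real.sqrt_pos.2 (by nlinarith)).ne'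
  have hsq := Real.sin_sq_add_cos_sq r
  refine ⟨r, (Real.sin r)⁻¹ • (y - Real.cos r • x), ?_, ?_, ?_, fun z h h' => ?_⟩
  · simp only [bform_smul_left, bform_smul_right, bform_sub_left, bform_sub_right, hx, hy,
      bform_comm n y x]
    rw [show bform n x y = -Real.cos r by linarith]
    field_simp
    linear_combination hsq
  · simp only [bform_smul_right, bform_sub_right, hx]
    rw [hr]
    ring
  · rw [smul_inv_smul₀ hs]
    abel
  · simp only [bform_smul_right, bform_sub_right, h, h']
    ring

/-- The common perpendicular of two geodesics at a critical point with `⟨ℓ(t),ℓ'(s)⟩ ≥ -1`. -/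
lemma exists_common_perpendicular (n : ℕ) (hn : 1 ≤ n) {a b a' b' : Fin (n + 3) → ℝ}
    (ha : bform n a a = 0) (hb : bform n b b = 0) (ha' : bform n a' a' = 0)
    (hb' : bform n b' b' = 0) (hab : bform n a b < 0) (hab' : bform n a' b' < 0)
    (haa' : bform n a a' < 0) (hba' : bform n b a' < 0) {t s : ℝ}
    (hle : -1 ≤ bform n (lgeo n a b t) (lgeo n a' b' s))
    (hneg : bform n (lgeo n a b t) (lgeo n a' b' s) < 0)
    (hd : bform n (dlgeo n a b t) (lgeo n a' b' s) = 0)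
    (hd' : bform n (dlgeo n a' b' s) (lgeo n a b t) = 0) :
    ∃ r : ℝ, ∃ v : Fin (n + 3) → ℝ, bform n v v = -1 ∧
      bform n (lgeo n a b t) v = 0 ∧ bform n (dlgeo n a b t) v = 0 ∧
      lgeo n a' b' s = Real.cos r • lgeo n a b t + Real.sin r • v ∧
      bform n (dlgeo n a' b' s) (-Real.sin r • lgeo n a b t + Real.cos r • v) = 0 := by
  have hx := bform_lgeo_self n ha hb hab t
  have hy := bform_lgeo_self n ha' hb' hab' s
  have hdx := bform_dlgeo_lgeo n ha hb t
  have hdy := bform_dlgeo_lgeo n ha' hb' s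
  rcases hle.lt_or_eq with hlt | heq
  · obtain ⟨r, v, hv, hxv, hyv, hz⟩ := exists_timelike_geodesic n hx hy hlt (by linarith)
    refine ⟨r, v, hv, hxv, hz _ hdx hd, hyv, ?_⟩
    rw [bform_add_right, bform_smul_right, bform_smul_right, hd', hz _ hd' hdy]
    ring
  · obtain ⟨h1, h2⟩ := bform_eq_zero_of_lgeo n hab (t := t)
      (x := lgeo n a' b' s - lgeo n a b t)
      (by rw [bform_sub_right, hx, ← heq, sub_self]) (by rw [bform_sub_right, hdx, hd, sub_self])
    obtain ⟨h3, -⟩ := bform_eq_zero_of_lgeo n hab' (t := s)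
      (x := lgeo n a' b' s - lgeo n a b t)
      (by rw [bform_sub_right, hy, bform_comm n _ (lgeo n a b t), ← heq, sub_self])
      (by rw [bform_sub_right, hdy, hd', sub_self])
    have hyx : lgeo n a' b' s = lgeo n a b t := sub_eq_zero.1 <|
      eq_zero_of_orthogonal_triple n ha hb ha' hab haa' hba' h1 h2 h3 (by
        simp only [bform_sub_left, bform_sub_right, hx, hy, ← heq,
          bform_comm n (lgeo n a' b' s) (lgeo n a b t)]
        norm_num)
    obtain ⟨v, hv, hav, hbv, hav'⟩ :=
      exists_unit_timelike_orthogonal n hn ha hb ha' hab haa' hba'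
    have hxv : bform n (lgeo n a b t) v = 0 := by
      rw [bform_lgeo_left, hav, hbv]
      ring
    have hyv : bform n (lgeo n a' b' s) v = 0 := by rw [hyx, hxv]
    refine ⟨0, v, hv, hxv, ?_, by simp [hyx], ?_⟩
    · rw [bform_dlgeo_left, hav, hbv]
      ring
    · rw [bform_lgeo_left, hav'] at hyv
      rw [bform_add_right, bform_smul_right, bform_smul_right, hd', bform_dlgeo_left, hav',
        Real.cos_zero]
      linear_combination -hyv

/-- The minimum value detects crossing along an acausal curve. -/
lemma minValue_crossing (n : ℕ) {ξ : ℝ → (Fin (n + 3) → ℝ)} (hcont : Continuous ξ)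
    (hiso : ∀ t, bform n (ξ t) (ξ t) = 0)
    (hneg : ∀ s t : ℝ, s ≠ t → bform n (ξ s) (ξ t) < 0)
    {x y x' y' : ℝ} (hxy : x ≠ y) (hxx' : x ≠ x') (hxy' : x ≠ y') (hyx' : y ≠ x') (hyy' : y ≠ y')
    (hx'y' : x' ≠ y') :
    (Crossing x y x' y' → minValue n (ξ x) (ξ y) (ξ x') (ξ y') ≤ 1) ∧
    (¬ Crossing x y x' y' → 1 < minValue n (ξ x) (ξ y) (ξ x') (ξ y')) := by
  have hsymm : ∀ s t, -bform n (ξ s) (ξ t) = -bform n (ξ t) (ξ s) :=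
    fun s t => by rw [bform_comm]
  have hpos : ∀ s t, s ≠ t → 0 < -bform n (ξ s) (ξ t) := fun s t h => neg_pos.2 (hneg s t h)
  have hG : ∀ s, Continuous fun t => -bform n (ξ s) (ξ t) := fun s => by
    unfold bform
    fun_prop
  have key := ptolemy_crossing (G := fun s t => -bform n (ξ s) (ξ t)) hsymm hpos
    (fun s t u v => ptolemy_of_lt hG hsymm (fun s => by simp [hiso]) hpos
      fun a b c d hab hac hbc => by
      simpa only [neg_mul_neg] using gram_nonneg n (hiso a) (hiso b) (hiso c) (hiso d)
        (hneg a b hab) (hneg a c hac) (hneg b c hbc))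
    hxy hxx' hxy' hyx' hyy' hx'y'
  simp only [neg_mul_neg] at key
  rw [minValue_eq n (hneg _ _ hxy) (hneg _ _ hx'y')]
  have hp := Real.sqrt_pos.2 (mul_pos_of_neg_of_neg (hneg _ _ hxy) (hneg _ _ hx'y'))
  rwa [div_le_one hp, one_lt_div hp]

/-- Let `a = ξ(t_a), b = ξ(t_b), a' = ξ(t_{a'}), b' = ξ(t_{b'})` be four distinct points on
an acausal curve `ξ` (lifted so that all pairwise products are negative), with associated
spacelike geodesics `ℓ = [a,b]` and `ℓ' = [a',b']`, and let
`m = √(⟨a,a'⟩⟨b,b'⟩/(⟨a,b⟩⟨a',b'⟩)) + √(⟨a,b'⟩⟨b,a'⟩/(⟨a,b⟩⟨a',b'⟩))` be the minimum of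
`-⟨ℓ(t),ℓ'(s)⟩`.  If the pairs `(a,b)` and `(a',b')` are disjoint in the cyclic order of
the curve, then `m > 1`, so `ℓ` and `ℓ'` are disjoint and `ℓ ∪ ℓ'` is acausal (all mixed
products are `< -1`); if the pairs are crossing, then `m ≤ 1` and there is a timelike
geodesic `r ↦ cos(r)·ℓ(t₀) + sin(r)·v`, through the points realizing the minimum,
orthogonal to both `ℓ` and `ℓ'`. -/
theorem stmt15 (n : ℕ) (hn : 1 ≤ n) (ξ : ℝ → (Fin (n + 3) → ℝ))
    (hcont : Continuous ξ)
    (hiso : ∀ t, bform n (ξ t) (ξ t) = 0)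
    (hneg : ∀ s t : ℝ, s ≠ t → bform n (ξ s) (ξ t) < 0)
    (ta tb ta' tb' : ℝ) (hdist : List.Pairwise (· ≠ ·) [ta, tb, ta', tb'])
    (a b a' b' : Fin (n + 3) → ℝ)
    (hA : a = ξ ta) (hB : b = ξ tb) (hA' : a' = ξ ta') (hB' : b' = ξ tb') :
    (¬ Crossing ta tb ta' tb' →
      1 < Real.sqrt ((bform n a a' * bform n b b') / (bform n a b * bform n a' b')) +
            Real.sqrt ((bform n a b' * bform n b a') / (bform n a b * bform n a' b')) ∧
      (∀ t s : ℝ, lgeo n a b t ≠ lgeo n a' b' s) ∧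
      (∀ t s : ℝ, bform n (lgeo n a b t) (lgeo n a' b' s) < -1)) ∧
    (Crossing ta tb ta' tb' →
      Real.sqrt ((bform n a a' * bform n b b') / (bform n a b * bform n a' b')) +
          Real.sqrt ((bform n a b' * bform n b a') / (bform n a b * bform n a' b')) ≤ 1 ∧
      ∃ t₀ s₀ r : ℝ, ∃ v : Fin (n + 3) → ℝ,
        (∀ t s : ℝ, -(bform n (lgeo n a b t₀) (lgeo n a' b' s₀)) ≤
            -(bform n (lgeo n a b t) (lgeo n a' b' s))) ∧
        bform n v v = -1 ∧
        bform n (lgeo n a b t₀) v = 0 ∧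
        bform n (dlgeo n a b t₀) v = 0 ∧
        lgeo n a' b' s₀ = Real.cos r • lgeo n a b t₀ + Real.sin r • v ∧
        bform n (dlgeo n a' b' s₀)
          (-Real.sin r • lgeo n a b t₀ + Real.cos r • v) = 0) := by
  simp only [List.pairwise_cons, List.mem_cons, List.not_mem_nil, or_false, forall_eq_or_imp,
    forall_eq] at hdist
  obtain ⟨⟨h1, h2, h3⟩, ⟨h4, h5⟩, h6, -⟩ := hdist
  obtain ⟨hcr, hncr⟩ := minValue_crossing n hcont hiso hneg h1 h2 h3 h4 h5 h6
  rw [← hA, ← hB, ← hA', ← hB'] at hcr hncr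
  have hab : bform n a b < 0 := hA ▸ hB ▸ hneg _ _ h1
  have haa' : bform n a a' < 0 := hA ▸ hA' ▸ hneg _ _ h2
  have hab' : bform n a b' < 0 := hA ▸ hB' ▸ hneg _ _ h3
  have hba' : bform n b a' < 0 := hB ▸ hA' ▸ hneg _ _ h4
  have hbb' : bform n b b' < 0 := hB ▸ hB' ▸ hneg _ _ h5
  have ha'b' : bform n a' b' < 0 := hA' ▸ hB' ▸ hneg _ _ h6
  have ha : bform n a a = 0 := hA ▸ hiso ta
  have hb : bform n b b = 0 := hB ▸ hiso tb
  have ha' : bform n a' a' = 0 := hA' ▸ hiso ta'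
  have hb' : bform n b' b' = 0 := hB' ▸ hiso tb'
  have hmin := minValue_le n hab ha'b' haa' hbb' hab' hba'
  refine ⟨fun hc => ?_, fun hc => ?_⟩
  · have hlt : ∀ t s, bform n (lgeo n a b t) (lgeo n a' b' s) < -1 := fun t s => by
      linarith [hncr hc, hmin t s]
    refine ⟨hncr hc, fun t s h => ?_, hlt⟩
    have := hlt t s
    rw [← h, bform_lgeo_self n ha hb hab] at this
    exact this.false
  · obtain ⟨t, s, hts, hd, hd'⟩ := exists_lgeo_eq_minValue n hab ha'b' haa' hbb' hab' hba'
    have hm := hcr hc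
    have hm0 : 0 < minValue n a b a' b' := by
      have hp := mul_pos_of_neg_of_neg hab ha'b'
      exact add_pos (Real.sqrt_pos.2 (div_pos (mul_pos_of_neg_of_neg haa' hbb') hp))
        (Real.sqrt_pos.2 (div_pos (mul_pos_of_neg_of_neg hab' hba') hp))
    obtain ⟨r, v, hv⟩ := exists_common_perpendicular n hn ha hb ha' hb' hab ha'b' haa' hba'
      (by linarith) (by linarith) hd hd'
    exact ⟨hm, t, s, r, v, fun t' s' => by rw [hts, neg_neg]; exact hmin t' s', hv⟩
end

section
/- Let D and D' be compact topological n-disks in ℝⁿ with D ⊆ D' and ∂D ⊆ ∂D'. Then D = D'. -/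
open MeasureTheory Metric Set Polynomial

section BallPerturbation

variable {E : Type*} [NormedAddCommGroup E]

theorem id_add_injective_of_lipschitzWith {p : E → E} {K : NNReal} (hK : K < 1)
    (hp : LipschitzWith K p) : Function.Injective fun x => x + p x := by
  intro x y hxy
  have h1 := hp.dist_le_mul x y
  have h2 : dist (p x) (p y) = dist x y := by
    rw [dist_eq_norm, dist_eq_norm, ← norm_neg (x - y)]
    congr 1
    have : x + p x = y + p y := hxy
    rw [neg_sub, sub_eq_sub_iff_add_eq_add, add_comm, this, add_comm]
  have h3 : (K : ℝ) < 1 := hK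
  refine dist_le_zero.1 ?_
  nlinarith [dist_nonneg (x := x) (y := y)]

theorem id_add_surjective_of_lipschitzWith [CompleteSpace E] {p : E → E} {K : NNReal} (hK : K < 1)
    (hp : LipschitzWith K p) : Function.Surjective fun x => x + p x := by
  intro y
  have hc : ContractingWith K fun x => y - p x := by
    refine ⟨hK, LipschitzWith.of_dist_le_mul fun a b => ?_⟩
    rw [dist_sub_left]
    exact hp.dist_le_mul a b
  have h := hc.fixedPoint_isFixedPt
  exact ⟨_, eq_sub_iff_add_eq.1 h.symm⟩

theorem id_add_image_of_lipschitzWith [CompleteSpace E] {p : E → E} {K : NNReal} (hK : K < 1)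
    (hp : LipschitzWith K p) {s : Set E} (hs : ∀ x ∉ s, p x = 0) :
    (fun x => x + p x) '' s = s := by
  have hb : Function.Bijective fun x => x + p x :=
    ⟨id_add_injective_of_lipschitzWith hK hp, id_add_surjective_of_lipschitzWith hK hp⟩
  have hc : (fun x => x + p x) '' sᶜ = sᶜ := by
    rw [image_congr (g := id) fun x hx => by simp [hs x hx], image_id]
  rw [← compl_inj_iff, ← image_compl_eq hb, hc]

variable [InnerProductSpace ℝ E]

theorem exists_polynomial_one_sub_norm_sq_pow (c : ℝ) (m : ℕ) (x v : E) :
    ∃ p : ℝ[X], p.natDegree ≤ 2 * m ∧ ∀ t : ℝ, p.eval t = (1 - c * ‖x + t • v‖ ^ 2) ^ m := by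
  refine ⟨(1 - C c * (C (‖x‖ ^ 2) + C (2 * inner ℝ x v) * X + C (‖v‖ ^ 2) * X ^ 2)) ^ m, ?_, ?_⟩
  · compute_degree
    omega
  · intro t
    rw [norm_add_sq_real, norm_smul, mul_pow, Real.norm_eq_abs, sq_abs, inner_smul_right]
    simp only [eval_pow, eval_sub, eval_mul, eval_add, eval_C, eval_X, eval_one]
    ring

variable [FiniteDimensional ℝ E]

theorem ContinuousLinearMap.det_one_add_pos {A : E →L[ℝ] E} (hA : ‖A‖ < 1) : 0 < (1 + A).det := by
  have hcont : Continuous fun s : ℝ => (1 + s • A).det :=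
    ContinuousLinearMap.continuous_det.comp (by fun_prop)
  have hne : ∀ s ∈ Icc (0 : ℝ) 1, (1 + s • A).det ≠ 0 := by
    intro s hs h0
    obtain ⟨v, hv, hv0⟩ := (Submodule.ne_bot_iff _).1
      (LinearMap.bot_lt_ker_of_det_eq_zero (f := ((1 + s • A : E →L[ℝ] E) : E →ₗ[ℝ] E)) h0).ne'
    have hv' : v + s • A v = 0 := by simpa using hv
    have h1 : ‖v‖ = s * ‖A v‖ := by
      conv_lhs => rw [eq_neg_of_add_eq_zero_left hv', norm_neg, norm_smul, Real.norm_of_nonneg hs.1]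
    have h2 := A.le_opNorm v
    have h3 : 0 < ‖v‖ := norm_pos_iff.2 hv0
    nlinarith [mul_le_mul_of_nonneg_right hs.2 (norm_nonneg (A v))]
  by_contra! h
  have h0 : (0 : ℝ) ∈ Icc ((1 + (1 : ℝ) • A).det) ((1 + (0 : ℝ) • A).det) := by
    constructor
    · simpa using h
    · simp [ContinuousLinearMap.det]
  obtain ⟨s, hs, hs0⟩ := intermediate_value_Icc' zero_le_one hcont.continuousOn h0
  exact hne s hs hs0

theorem ContinuousLinearMap.exists_polynomial_det_one_add_smul (A : E →L[ℝ] E) :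
    ∃ p : ℝ[X], p.natDegree ≤ Module.finrank ℝ E ∧ ∀ t : ℝ, p.eval t = (1 + t • A).det := by
  let b := Module.finBasis ℝ E
  let M := LinearMap.toMatrix b b (A : E →ₗ[ℝ] E)
  refine ⟨((X : ℝ[X]) • M.map C + (1 : Matrix _ _ ℝ).map C).det, ?_, fun t => ?_⟩
  · simpa using natDegree_det_X_add_C_le M 1
  · rw [ContinuousLinearMap.det, ← LinearMap.det_toMatrix b, ← coe_evalRingHom, RingHom.map_det]
    congr 1
    ext i j
    by_cases h : i = j <;> simp [M, h, LinearMap.toMatrix_one] <;> ring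

/-- A family of functions depending polynomially on a parameter, whose integral is constant for
small values of the parameter, has constant integral. -/
theorem integral_eq_of_polynomial_param {α : Type*} [MeasurableSpace α] {μ : Measure α} {N : ℕ}
    {q : ℝ → α → ℝ} {τ c : ℝ} (hτ : 0 < τ)
    (hq : ∀ x, ∃ p : ℝ[X], p.natDegree ≤ N ∧ ∀ t, p.eval t = q t x)
    (hint : ∀ t ∈ Icc 0 τ, Integrable (q t) μ) (hc : ∀ t ∈ Icc 0 τ, ∫ x, q t x ∂μ = c) (t : ℝ) :
    ∫ x, q t x ∂μ = c := by
  let s := Finset.range (N + 1)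
  let v : ℕ → ℝ := fun i => τ / (i + 1)
  have hv : InjOn v s := by
    intro i _ j _ hij
    have hij : τ / ((i : ℝ) + 1) = τ / (j + 1) := hij
    field_simp at hij
    exact_mod_cast (add_right_cancel hij).symm
  have hvm : ∀ i, v i ∈ Icc 0 τ := fun i =>
    ⟨by positivity, div_le_self hτ.le (by linarith [(Nat.cast_nonneg i : (0 : ℝ) ≤ i)])⟩
  have key : ∀ x, q t x = ∑ i ∈ s, q (v i) x * (Lagrange.basis s v i).eval t := by
    intro x
    obtain ⟨p, hp, hpq⟩ := hq x
    have hdeg : p.degree < s.card := by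
      rw [Finset.card_range]
      exact degree_le_natDegree.trans_lt (by exact_mod_cast Nat.lt_succ_of_le hp)
    rw [← hpq, Lagrange.eq_interpolate hv hdeg, Lagrange.interpolate_apply, eval_finsetSum]
    simp [hpq]
  simp_rw [key]
  rw [integral_finsetSum _ fun i _ => (hint _ (hvm i)).mul_const _]
  simp_rw [integral_mul_const, hc _ (hvm _), ← Finset.mul_sum]
  rw [← eval_finsetSum, Lagrange.sum_basis hv (by simp [s])]
  simp

variable [MeasurableSpace E] [BorelSpace E]

theorem integral_comp_id_add_smul_mul_det {k : E → E} (hk : ContDiff ℝ 1 k) {R : ℝ}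
    (hkR : ∀ x ∉ closedBall (0 : E) R, k x = 0) {K : NNReal} (hK : LipschitzWith K k) {t : ℝ}
    (ht : |t| * K < 1) (P : E → ℝ) :
    ∫ x in closedBall (0 : E) R, P (x + t • k x) * (1 + t • fderiv ℝ k x).det =
      ∫ x in closedBall (0 : E) R, P x := by
  have hlip : LipschitzWith (‖t‖₊ * K) fun x => t • k x := by
    simpa using! (lipschitzWith_smul t).comp hK
  have ht' : ‖t‖₊ * K < 1 := by exact_mod_cast ht
  have hd : ∀ x, HasFDerivAt (fun x => x + t • k x) (1 + t • fderiv ℝ k x) x := fun x =>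
    (hasFDerivAt_id x).add ((hk.differentiable one_ne_zero x).hasFDerivAt.const_smul t)
  conv_rhs => rw [← id_add_image_of_lipschitzWith ht' hlip (s := closedBall 0 R)
    fun x hx => by simp [hkR x hx]]
  rw [integral_image_eq_integral_abs_det_fderiv_smul _ measurableSet_closedBall
    (fun x _ => (hd x).hasFDerivWithinAt) (id_add_injective_of_lipschitzWith ht' hlip).injOn]
  congr with x
  rw [abs_of_pos, smul_eq_mul, mul_comm]
  apply ContinuousLinearMap.det_one_add_pos
  rw [norm_smul]
  exact (mul_le_mul_of_nonneg_left (norm_fderiv_le_of_lipschitz ℝ hK) (norm_nonneg t)).trans_lt ht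

theorem integral_one_sub_norm_sq_pow_mul_det {k : E → E} (hk : ContDiff ℝ 1 k) {R : ℝ}
    (hkR : ∀ x ∉ closedBall (0 : E) R, k x = 0) (c : ℝ) (m : ℕ) :
    ∫ x in closedBall (0 : E) R, (1 - c * ‖x + k x‖ ^ 2) ^ m * (1 + fderiv ℝ k x).det =
      ∫ x in closedBall (0 : E) R, (1 - c * ‖x‖ ^ 2) ^ m := by
  obtain ⟨K, hK⟩ := hk.lipschitzWith_of_hasCompactSupport
    (HasCompactSupport.intro (isCompact_closedBall 0 R) hkR) one_ne_zero
  have hcont := hk.continuous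
  have hdcont := hk.continuous_fderiv one_ne_zero
  have h := integral_eq_of_polynomial_param (μ := volume.restrict (closedBall (0 : E) R))
    (N := 2 * m + Module.finrank ℝ E) (τ := 1 / (K + 1))
    (q := fun t x => (1 - c * ‖x + t • k x‖ ^ 2) ^ m * (1 + t • fderiv ℝ k x).det)
    (c := ∫ x in closedBall (0 : E) R, (1 - c * ‖x‖ ^ 2) ^ m) (by positivity) ?_ ?_ ?_ 1
  · simpa using h
  · intro x
    obtain ⟨p₁, hp₁, h₁⟩ := exists_polynomial_one_sub_norm_sq_pow c m x (k x)
    obtain ⟨p₂, hp₂, h₂⟩ := (fderiv ℝ k x).exists_polynomial_det_one_add_smul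
    exact ⟨p₁ * p₂, natDegree_mul_le_of_le hp₁ hp₂, fun t => by rw [eval_mul, h₁, h₂]⟩
  · intro t _
    refine ContinuousOn.integrableOn_compact (isCompact_closedBall 0 R) (Continuous.continuousOn ?_)
    have := ContinuousLinearMap.continuous_det.comp
      (show Continuous fun x => 1 + t • fderiv ℝ k x by fun_prop)
    exact Continuous.mul (by fun_prop) this
  · intro t ht
    refine integral_comp_id_add_smul_mul_det hk hkR hK ?_ fun x => (1 - c * ‖x‖ ^ 2) ^ m
    rw [abs_of_nonneg ht.1]
    refine (mul_le_mul_of_nonneg_right ht.2 K.2).trans_lt ?_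
    rw [one_div_mul_eq_div, div_lt_one (by positivity)]
    exact lt_add_one _

/-- A compactly supported `C¹` perturbation of the identity vanishes somewhere. -/
theorem exists_add_eq_zero_of_contDiff {k : E → E} (hk : ContDiff ℝ 1 k)
    (hks : HasCompactSupport k) : ∃ x, x + k x = 0 := by
  by_contra! hne
  obtain ⟨R, hR0, hR⟩ : ∃ R > 0, ∀ x ∉ closedBall (0 : E) R, k x = 0 := by
    obtain ⟨R, hR0, hR⟩ := hks.isCompact.isBounded.subset_closedBall_lt 0 0
    exact ⟨R, hR0, fun x hx => image_eq_zero_of_notMem_tsupport fun h => hx (hR h)⟩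
  have hB := isCompact_closedBall (0 : E) R
  have hHc : Continuous fun x => x + k x := continuous_id.add hk.continuous
  have hne0 : (closedBall (0 : E) R).Nonempty := ⟨0, by simp [hR0.le]⟩
  obtain ⟨x₀, -, hx₀⟩ := hB.exists_isMinOn hne0 hHc.norm.continuousOn
  obtain ⟨M₀, hM₀⟩ := hB.exists_bound_of_continuousOn hHc.continuousOn
  have hdet : Continuous fun x => (1 + fderiv ℝ k x).det :=
    ContinuousLinearMap.continuous_det.comp
      (continuous_const.add (hk.continuous_fderiv one_ne_zero))
  obtain ⟨D, hD⟩ := hB.exists_bound_of_continuousOn hdet.continuousOn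
  obtain ⟨η, hη0, hηR, hη⟩ : ∃ η > 0, η ≤ R ∧ ∀ x ∈ closedBall (0 : E) R, η ≤ ‖x + k x‖ :=
    ⟨min R ‖x₀ + k x₀‖, lt_min hR0 (norm_pos_iff.2 (hne x₀)), min_le_left _ _,
      fun x hx => (min_le_right _ _).trans (hx₀ hx)⟩
  obtain ⟨M, hMR, hM⟩ : ∃ M, R ≤ M ∧ ∀ x ∈ closedBall (0 : E) R, ‖x + k x‖ ≤ M :=
    ⟨max R M₀, le_max_left _ _, fun x hx => (hM₀ x hx).trans (le_max_right _ _)⟩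
  have hM0 : 0 < M := hR0.trans_le hMR
  obtain ⟨c, hc0, hcM⟩ : ∃ c > 0, c * M ^ 2 = 1 :=
    ⟨(M ^ 2)⁻¹, by positivity, inv_mul_cancel₀ (by positivity)⟩
  have hle : ∀ {r s : ℝ}, 0 ≤ r → r ≤ s → 1 - c * s ^ 2 ≤ 1 - c * r ^ 2 := fun hr hrs => by
    gcongr
  have hnn : ∀ {s : ℝ}, 0 ≤ s → s ≤ M → 0 ≤ 1 - c * s ^ 2 := fun hs hsM => by
    linarith [hle hs hsM]
  have key : ∀ m : ℕ, (1 - c * (η / 2) ^ 2) ^ m * volume.real (closedBall (0 : E) (η / 2)) ≤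
      (1 - c * η ^ 2) ^ m * D * volume.real (closedBall (0 : E) R) := by
    intro m
    have hsub : closedBall (0 : E) (η / 2) ⊆ closedBall 0 R := 
      closedBall_subset_closedBall (by linarith)
    have hcont : Continuous fun x : E => (1 - c * ‖x‖ ^ 2) ^ m := by fun_prop
    calc (1 - c * (η / 2) ^ 2) ^ m * volume.real (closedBall (0 : E) (η / 2))
      _ = ∫ _ in closedBall (0 : E) (η / 2), (1 - c * (η / 2) ^ 2) ^ m := by
        rw [setIntegral_const, smul_eq_mul, mul_comm]
      _ ≤ ∫ x in closedBall (0 : E) (η / 2), (1 - c * ‖x‖ ^ 2) ^ m := by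
        refine setIntegral_mono_on (by simp [measure_closedBall_lt_top])
          (hcont.continuousOn.integrableOn_compact (isCompact_closedBall _ _))
          measurableSet_closedBall fun x hx => ?_
        rw [mem_closedBall_zero_iff] at hx
        exact pow_le_pow_left₀ (hnn (by positivity) (by linarith)) (hle (norm_nonneg x) hx) m
      _ ≤ ∫ x in closedBall (0 : E) R, (1 - c * ‖x‖ ^ 2) ^ m := by
        refine setIntegral_mono_set (hcont.continuousOn.integrableOn_compact hB) ?_
          (Filter.Eventually.of_forall hsub)
        filter_upwards [ae_restrict_mem measurableSet_closedBall] with x hx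
        rw [mem_closedBall_zero_iff] at hx
        exact pow_nonneg (hnn (norm_nonneg x) (hx.trans hMR)) m
      _ = ∫ x in closedBall (0 : E) R, (1 - c * ‖x + k x‖ ^ 2) ^ m * (1 + fderiv ℝ k x).det :=
        (integral_one_sub_norm_sq_pow_mul_det hk hR c m).symm
      _ ≤ ‖∫ x in closedBall (0 : E) R, (1 - c * ‖x + k x‖ ^ 2) ^ m * (1 + fderiv ℝ k x).det‖ :=
        Real.le_norm_self _
      _ ≤ _ := by
        refine norm_setIntegral_le_of_norm_le_const measure_closedBall_lt_top fun x hx => ?_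
        have h0 := hnn (norm_nonneg _) (hM x hx)
        rw [norm_mul, norm_pow, Real.norm_of_nonneg h0]
        exact mul_le_mul (pow_le_pow_left₀ h0 (hle hη0.le (hη x hx)) m) (hD x hx) (norm_nonneg _)
          (pow_nonneg (hnn hη0.le (hηR.trans hMR)) m)
  have hq : 0 ≤ 1 - c * η ^ 2 := hnn hη0.le (hηR.trans hMR)
  have hqq : 1 - c * η ^ 2 < 1 - c * (η / 2) ^ 2 := by nlinarith [mul_pos hc0 (pow_pos hη0 2)]
  have hq' := hq.trans_lt hqq
  have hlim := (tendsto_pow_atTop_nhds_zero_of_lt_one (div_nonneg hq hq'.le)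
    ((div_lt_one hq').2 hqq)).mul_const (D * volume.real (closedBall (0 : E) R))
  have hv : volume.real (closedBall (0 : E) (η / 2)) ≤
      0 * (D * volume.real (closedBall (0 : E) R)) := by
    refine ge_of_tendsto' hlim fun m => ?_
    have := key m
    rw [div_pow, div_mul_eq_mul_div, le_div_iff₀ (pow_pos hq' m)]
    linarith
  have hpos : 0 < volume.real (closedBall (0 : E) (η / 2)) :=
    ENNReal.toReal_pos (measure_closedBall_pos _ _ (by positivity)).ne' measure_closedBall_lt_top.ne
  linarith


/-- A form of the **Brouwer fixed point theorem** for `-k`. -/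
theorem exists_add_eq_zero_of_continuousOn {k : E → E} (hk : ContinuousOn k (closedBall 0 1))
    (hk1 : ∀ x ∈ closedBall (0 : E) 1, ‖k x‖ ≤ 1) : ∃ x ∈ closedBall (0 : E) 1, x + k x = 0 := by
  by_contra! hne
  obtain ⟨g, hg1, hgk⟩ := ContinuousMap.exists_forall_mem_restrict_eq
    (isClosed_closedBall (x := (0 : E)) (ε := 1)) ⟨_, hk.domRestrict⟩ (t := closedBall (0 : E) 1)
    fun x => by simpa using! hk1 x x.2
  have hg1 : ∀ x, ‖g x‖ ≤ 1 := fun x => by simpa using hg1 x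
  have hgk : ∀ x ∈ closedBall (0 : E) 1, g x = k x := fun x hx => DFunLike.congr_fun hgk ⟨x, hx⟩
  have hg0 : ∀ x, x + g x ≠ 0 := by
    intro x hx
    by_cases hxB : x ∈ closedBall (0 : E) 1
    · exact hne x hxB (hgk x hxB ▸ hx)
    · rw [mem_closedBall_zero_iff, eq_neg_of_add_eq_zero_left hx, norm_neg] at hxB
      exact hxB (hg1 x)
  let χ : ContDiffBump (0 : E) := ⟨2, 3, by norm_num, by norm_num⟩
  have hχ : ∀ x, ‖χ x • g x‖ ≤ 1 := fun x => by
    rw [norm_smul, Real.norm_of_nonneg χ.nonneg]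
    exact mul_le_one₀ χ.le_one (norm_nonneg _) (hg1 x)
  have hH0 : ∀ x, x + χ x • g x ≠ 0 := by
    intro x hx
    by_cases hx2 : x ∈ closedBall (0 : E) 2
    · rw [χ.one_of_mem_closedBall hx2, one_smul] at hx
      exact hg0 x hx
    · rw [mem_closedBall_zero_iff, eq_neg_of_add_eq_zero_left hx, norm_neg] at hx2
      linarith [hχ x]
  have hcont : Continuous fun x => χ x • g x := χ.continuous.smul g.continuous
  obtain ⟨h, hh, hhd, hhs⟩ := hcont.exists_contDiff_approx 1
    (ε := fun x => ‖x + χ x • g x‖) (continuous_id.add hcont).norm fun x => norm_pos_iff.2 (hH0 x)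
  have hcs : HasCompactSupport fun x => χ x • g x := χ.hasCompactSupport.smul_right
  obtain ⟨x, hx⟩ := exists_add_eq_zero_of_contDiff (by exact_mod_cast hh) (hcs.mono hhs)
  refine (hhd x).ne ?_
  rw [eq_neg_of_add_eq_zero_right hx, dist_eq_norm, ← norm_neg]
  congr 1
  abel

end BallPerturbation

section RadialPush

variable {E : Type*} [NormedAddCommGroup E] [NormedSpace ℝ E]

/-- The map fixing the points outside the ball and pushing the points of the punctured ball
radially onto the sphere. -/
noncomputable def radialPush (c : E) (ε : ℝ) (y : E) : E :=
  c + max (ε / ‖y - c‖) 1 • (y - c)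

theorem radialPush_of_le {c : E} {ε : ℝ} {y : E} (hε : 0 < ε) (h : ε ≤ ‖y - c‖) :
    radialPush c ε y = y := by
  rw [radialPush, max_eq_right ((div_le_one (hε.trans_le h)).2 h)]
  simp

theorem radialPush_mem_sphere {c : E} {ε : ℝ} {y : E} (hy : y ≠ c) (h : ‖y - c‖ ≤ ε) :
    radialPush c ε y ∈ sphere c ε := by
  have h0 : 0 < ‖y - c‖ := norm_pos_iff.2 (sub_ne_zero.2 hy)
  rw [radialPush, max_eq_left ((one_le_div h0).2 h), mem_sphere_iff_norm, add_sub_cancel_left,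
    norm_smul, Real.norm_of_nonneg (div_nonneg (h0.le.trans h) h0.le), div_mul_cancel₀ _ h0.ne']

theorem continuousOn_radialPush (c : E) (ε : ℝ) : ContinuousOn (radialPush c ε) {c}ᶜ := by
  unfold radialPush
  have : ∀ y ∈ ({c}ᶜ : Set E), ‖y - c‖ ≠ 0 := fun y hy => norm_ne_zero_iff.2 (sub_ne_zero.2 hy)
  fun_prop (disch := assumption)

/-- A continuous left inverse on the image of a compact set extends to the whole space. -/
theorem exists_continuous_leftInvOn {X : Type*} [TopologicalSpace X] [NormalSpace X] [T2Space X]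
    [FiniteDimensional ℝ E] {f : E → X} {s : Set E} (hs : IsCompact s)
    (hf : ContinuousOn f s) (hfi : InjOn f s) :
    ∃ G : C(X, E), LeftInvOn G f s := by
  have : CompactSpace s := isCompact_iff_compactSpace.1 hs
  have he : Topology.IsClosedEmbedding (s.domRestrict f) :=
    hf.domRestrict.isClosedEmbedding hfi.injective
  obtain ⟨G, hG⟩ := ContinuousMap.exists_extension' he ⟨Subtype.val, continuous_subtype_val⟩
  exact ⟨G, fun x hx => congr_fun hG ⟨x, hx⟩⟩

end RadialPush

section InvarianceOfDomain

variable {E : Type*} [NormedAddCommGroup E] [InnerProductSpace ℝ E] [FiniteDimensional ℝ E]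
  [MeasurableSpace E] [BorelSpace E]

/-- A continuous function can be approximated by a smooth one which avoids zero on a given
sphere. -/
theorem Continuous.exists_dist_lt_forall_sphere_ne_zero {G : E → E} (hG : Continuous G) (c : E)
    {ε δ : ℝ} (hε : 0 < ε) (hδ : 0 < δ) :
    ∃ P : E → E, Continuous P ∧ (∀ x, dist (P x) (G x) < δ) ∧ ∀ x ∈ sphere c ε, P x ≠ 0 := by
  obtain ⟨Q, hQ, hQd, -⟩ := hG.exists_contDiff_approx 1 (ε := fun _ => δ / 2) continuous_const
    fun _ => half_pos hδ
  have hnull : volume (Q '' sphere c ε) = 0 :=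
    addHaar_image_eq_zero_of_differentiableOn_of_addHaar_eq_zero _
      (hQ.differentiable (by simp)).differentiableOn
      (Measure.addHaar_sphere_of_ne_zero _ c hε.ne')
  obtain ⟨v, hvball, hv⟩ : (ball (0 : E) (δ / 2) \ Q '' sphere c ε).Nonempty := by
    refine nonempty_of_measure_ne_zero (μ := volume) ?_
    rw [measure_sdiff_null hnull]
    exact (measure_ball_pos _ _ (half_pos hδ)).ne'
  rw [mem_ball_zero_iff] at hvball
  refine ⟨fun x => Q x - v, hQ.continuous.sub continuous_const, fun x => ?_, fun x hx h0 => ?_⟩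
  · have h1 : dist (Q x - v) (Q x) = ‖v‖ := by simp
    linarith [dist_triangle (Q x - v) (Q x) (G x), hQd x]
  · exact hv ⟨x, hx, sub_eq_zero.1 h0⟩

/-- **Invariance of domain** at the center of the unit ball. -/
theorem mem_interior_image_closedBall_one {f : E → E} (hf : ContinuousOn f (closedBall 0 1))
    (hfi : InjOn f (closedBall 0 1)) : f 0 ∈ interior (f '' closedBall 0 1) := by
  have hB := isCompact_closedBall (0 : E) 1
  have h0B : (0 : E) ∈ closedBall (0 : E) 1 := by simp
  obtain ⟨G, hG⟩ := exists_continuous_leftInvOn hB hf hfi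
  by_contra hint
  obtain ⟨r, hr0, hr⟩ := Metric.continuous_iff.1 G.continuous (f 0) (1 / 10) (by norm_num)
  simp_rw [hG h0B, dist_zero_right] at hr
  obtain ⟨ε, hε, hεr⟩ : ∃ ε > 0, 2 * ε < r := ⟨r / 3, by positivity, by linarith⟩
  obtain ⟨c, hcε, hc⟩ : ∃ c ∈ ball (f 0) ε, c ∉ f '' closedBall 0 1 := by
    by_contra! h
    exact hint (mem_interior_iff_mem_nhds.2 (Filter.mem_of_superset (ball_mem_nhds _ hε) h))
  rw [mem_ball'] at hcε
  let S := f '' closedBall 0 1 ∩ {y | ε ≤ ‖y - c‖}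
  have hS : IsCompact S := (hB.image_of_continuousOn hf).inter_right
    (isClosed_le continuous_const (by fun_prop))
  have hGS : ∀ y ∈ S, 0 < ‖G y‖ := by
    rintro _ ⟨⟨x, hx, rfl⟩, hxc⟩
    rw [norm_pos_iff, hG hx]
    rintro rfl
    rw [mem_ofPred_eq, ← dist_eq_norm] at hxc
    linarith
  obtain ⟨δ, hδ0, hδ⟩ : ∃ δ > 0, ∀ y ∈ S, δ ≤ ‖G y‖ := by
    rcases S.eq_empty_or_nonempty with h | h
    · exact ⟨1, one_pos, by simp [h]⟩
    · obtain ⟨y, hy, hmin⟩ := hS.exists_isMinOn h G.continuous.norm.continuousOn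
      exact ⟨_, hGS y hy, hmin⟩
  obtain ⟨P, hP, hPG, hPs⟩ := G.continuous.exists_dist_lt_forall_sphere_ne_zero c hε
    (lt_min hδ0 (show (0 : ℝ) < 1 / 10 by norm_num))
  have hfc : ∀ x ∈ closedBall (0 : E) 1, f x ≠ c := fun x hx h => hc ⟨x, hx, h⟩
  have hcont : ContinuousOn (fun x => P (radialPush c ε (f x)) - x) (closedBall 0 1) :=
    (hP.comp_continuousOn ((continuousOn_radialPush c ε).comp hf hfc)).sub continuousOn_id
  obtain ⟨x, hx, hx0⟩ := exists_add_eq_zero_of_continuousOn hcont fun x hx => by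
    have h1 := (hPG (radialPush c ε (f x))).trans_le (min_le_right _ _)
    rw [← dist_eq_norm]
    rcases le_total ε ‖f x - c‖ with h | h
    · rw [radialPush_of_le hε h, hG hx] at h1
      rw [radialPush_of_le hε h]
      linarith
    · have h2 := hr (radialPush c ε (f x)) <| by
        have := mem_sphere.1 (radialPush_mem_sphere (hfc x hx) h)
        linarith [dist_triangle_right (radialPush c ε (f x)) (f 0) c]
      have h3 := hr (f x) <| by
        rw [← dist_eq_norm] at h
        linarith [dist_triangle_right (f x) (f 0) c]
      rw [hG hx] at h3
      have h4 := dist_le_norm_add_norm (G (radialPush c ε (f x))) x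
      linarith [dist_triangle (P (radialPush c ε (f x))) (G (radialPush c ε (f x))) x]
  have hPx : P (radialPush c ε (f x)) = 0 := by simpa using hx0
  rcases le_total ε ‖f x - c‖ with h | h
  · rw [radialPush_of_le hε h] at hPx
    have h1 := (hPG (f x)).trans_le (min_le_left _ _)
    rw [hPx, dist_zero_left] at h1
    exact h1.not_ge (hδ _ ⟨mem_image_of_mem f hx, h⟩)
  · exact hPs _ (radialPush_mem_sphere (hfc x hx) h) hPx

/-- **Invariance of domain**: the image of an open set under a continuous injective map is
open. -/
theorem isOpen_image_of_continuousOn_of_injOn {f : E → E} {U : Set E} (hU : IsOpen U)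
    (hf : ContinuousOn f U) (hfi : InjOn f U) : IsOpen (f '' U) := by
  rw [isOpen_iff_mem_nhds]
  rintro _ ⟨x, hx, rfl⟩
  obtain ⟨r, hr, hrU⟩ := nhds_basis_closedBall.mem_iff.1 (hU.mem_nhds hx)
  let a : E → E := fun z => x + r • z
  have ha : MapsTo a (closedBall 0 1) U := by
    intro z hz
    apply hrU
    rw [mem_closedBall_zero_iff] at hz
    simpa [a, norm_smul, abs_of_pos hr] using mul_le_mul_of_nonneg_left hz hr.le
  have hai : Function.Injective a := fun y z h => by simpa [a, hr.ne'] using h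
  have h := mem_interior_image_closedBall_one (f := f ∘ a)
    (hf.comp (by fun_prop) ha) (hfi.comp hai.injOn ha)
  rw [mem_interior_iff_mem_nhds] at h
  have h0 : (f ∘ a) 0 = f x := by simp [a]
  rw [h0] at h
  refine Filter.mem_of_superset h ?_
  rintro _ ⟨z, hz, rfl⟩
  exact mem_image_of_mem f (ha hz)

/-- A continuous injective self-map of the closed unit ball which maps the unit sphere to itself
is surjective. -/
theorem image_closedBall_eq_of_mapsTo_sphere {h : E → E} (hc : ContinuousOn h (closedBall 0 1))
    (hi : InjOn h (closedBall 0 1)) (hm : MapsTo h (closedBall 0 1) (closedBall 0 1))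
    (hs : MapsTo h (sphere 0 1) (sphere 0 1)) : h '' closedBall 0 1 = closedBall 0 1 := by
  have hopen : IsOpen (h '' ball 0 1) := isOpen_image_of_continuousOn_of_injOn isOpen_ball
    (hc.mono ball_subset_closedBall) (hi.mono ball_subset_closedBall)
  have hclosed : IsClosed (h '' closedBall 0 1) :=
    ((isCompact_closedBall 0 1).image_of_continuousOn hc).isClosed
  have hsub : h '' ball 0 1 ⊆ ball 0 1 := by
    refine Subset.trans ?_ (interior_closedBall (0 : E) one_ne_zero).subset
    exact interior_maximal ((image_mono ball_subset_closedBall).trans hm.image_subset) hopen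
  have hball : ball (0 : E) 1 ⊆ h '' ball 0 1 := by
    refine (convex_ball (0 : E) 1).isPreconnected.subset_left_of_subset_union hopen
      hclosed.isOpen_compl ?_ ?_ ?_
    · exact disjoint_compl_right.mono_left (image_mono ball_subset_closedBall)
    · intro y hy
      by_cases hyB : y ∈ h '' closedBall 0 1
      · obtain ⟨x, hx, rfl⟩ := hyB
        rw [← ball_union_sphere] at hx
        rcases hx with hx | hx
        · exact Or.inl (mem_image_of_mem h hx)
        · have h1 := hs hx
          rw [mem_sphere] at h1
          exact absurd hy (by simp [mem_ball, h1])
      · exact Or.inr hyB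
    · have h0 : h 0 ∈ h '' ball 0 1 := mem_image_of_mem h (by simp)
      exact ⟨h 0, hsub h0, h0⟩
  refine hm.image_subset.antisymm ?_
  refine (closure_ball (0 : E) one_ne_zero).symm.subset.trans ?_
  exact closure_minimal (hball.trans (image_mono ball_subset_closedBall)) hclosed

end InvarianceOfDomain


/-- Let `D` and `D'` be compact topological `n`-disks in `ℝⁿ` (homeomorphic images of the
closed unit ball, given by continuous injective maps `f`, `g` on the closed unit ball),
with boundaries `∂D = f''(sphere)` and `∂D' = g''(sphere)`.  If `D ⊆ D'` and
`∂D ⊆ ∂D'`, then `D = D'`. -/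
theorem stmt16 (n : ℕ)
    (f g : EuclideanSpace ℝ (Fin n) → EuclideanSpace ℝ (Fin n))
    (hf : ContinuousOn f (Metric.closedBall 0 1))
    (hfi : Set.InjOn f (Metric.closedBall 0 1))
    (hg : ContinuousOn g (Metric.closedBall 0 1))
    (hgi : Set.InjOn g (Metric.closedBall 0 1))
    (D D' : Set (EuclideanSpace ℝ (Fin n)))
    (hD : D = f '' Metric.closedBall 0 1) (hD' : D' = g '' Metric.closedBall 0 1)
    (hsub : D ⊆ D')
    (hbd : f '' Metric.sphere 0 1 ⊆ g '' Metric.sphere 0 1) :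
    D = D' := by
  subst hD hD'
  obtain ⟨G, hG⟩ := exists_continuous_leftInvOn (isCompact_closedBall 0 1) hg hgi
  have hgG : ∀ x ∈ closedBall 0 1, g (G (f x)) = f x := by
    intro x hx
    obtain ⟨y, hy, hyx⟩ := hsub (mem_image_of_mem f hx)
    rw [← hyx, hG hy]
  have h := image_closedBall_eq_of_mapsTo_sphere (h := G ∘ f)
    (G.continuous.comp_continuousOn hf) ?_ ?_ ?_
  · conv_rhs => rw [← h, ← image_comp]
    exact (image_congr hgG).symm
  · intro x hx y hy hxy
    apply hfi hx hy
    rw [← hgG x hx, ← hgG y hy]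
    exact congrArg g hxy
  · intro x hx
    obtain ⟨y, hy, hyx⟩ := hsub (mem_image_of_mem f hx)
    simpa only [Function.comp, ← hyx, hG hy] using hy
  · intro x hx
    obtain ⟨y, hy, hyx⟩ := hbd (mem_image_of_mem f hx)
    simpa only [Function.comp, ← hyx, hG (sphere_subset_closedBall hy)] using hy
end
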